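/- The clipped Advantage Learning operator is gap-increasing: for every Q_0 : S × A → ℝ, defining Q_{k+1} = T_clip Q_k and V_k(s) = max_a Q_k(s,a), for every state s and action a one has liminf_{k→∞} [V_k(s) − Q_k(s,a)] ≥ V*(s) − Q*(s,a). -/

import Mathlib

open Filter Topology Finset

/-- Value function induced by a Q-function: `V_Q(s) = max_a Q(s,a)`. -/
noncomputable def Vof {S A : Type*} [Fintype A] [Nonempty A]
    (Q : S → A → ℝ) (s : S) : ℝ := ⨆ a, Q s a

/-- Bellman optimality operator `(T Q)(s,a) = r(s,a) + γ Σ_{s'} P(s'|s,a) V_Q(s')`. -/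
noncomputable def bellmanOp {S A : Type*} [Fintype S] [Fintype A] [Nonempty A]
    (P : S → A → S → ℝ) (r : S → A → ℝ) (γ : ℝ)
    (Q : S → A → ℝ) : S → A → ℝ :=
  fun s a => r s a + γ * ∑ s', P s a s' * Vof Q s'

/-- Advantage Learning operator `(T_AL Q)(s,a) = (T Q)(s,a) - α (V_Q(s) - Q(s,a))`. -/
noncomputable def alOp {S A : Type*} [Fintype S] [Fintype A] [Nonempty A]
    (P : S → A → S → ℝ) (r : S → A → ℝ) (γ α : ℝ)
    (Q : S → A → ℝ) : S → A → ℝ :=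
  fun s a => bellmanOp P r γ Q s a - α * (Vof Q s - Q s a)

/-- Clipped Advantage Learning operator. -/
noncomputable def clipOp {S A : Type*} [Fintype S] [Fintype A] [Nonempty A]
    (P : S → A → S → ℝ) (r : S → A → ℝ) (γ α c Ql : ℝ)
    (Q : S → A → ℝ) : S → A → ℝ :=
  fun s a => if Q s a - Ql ≥ c * (Vof Q s - Ql)
    then alOp P r γ α Q s a else bellmanOp P r γ Q s a

/-- Sup norm over a finite nonempty domain. -/
noncomputable def supNorm {S : Type*} [Fintype S] [Nonempty S] (f : S → ℝ) : ℝ :=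
  ⨆ s, |f s|


theorem Vof_ge {S A : Type*} [Fintype A] [Nonempty A] (Q : S → A → ℝ) (s : S) (a : A) :
    Q s a ≤ Vof Q s := le_ciSup (Set.finite_range (Q s)).bddAbove a

theorem Vof_att {S A : Type*} [Fintype A] [Nonempty A] (Q : S → A → ℝ) (s : S) :
    ∃ a, Q s a = Vof Q s := exists_eq_ciSup_of_finite (f := Q s)

theorem avg_mono {S : Type*} [Fintype S] (p : S → ℝ) (h0 : ∀ s, 0 ≤ p s) (h1 : ∑ s, p s = 1)
    (v w : S → ℝ) (d : ℝ) (h : ∀ s, v s ≤ w s + d) :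
    ∑ s, p s * v s ≤ ∑ s, p s * w s + d := by
  calc ∑ s, p s * v s ≤ ∑ s, p s * (w s + d) :=
        Finset.sum_le_sum fun s _ => mul_le_mul_of_nonneg_left (h s) (h0 s)
    _ = _ := by simp only [mul_add, Finset.sum_add_distrib, ← Finset.sum_mul, h1, one_mul]

theorem exists_ub {S : Type*} [Fintype S] (f : S → ℝ) : ∃ C, 0 ≤ C ∧ ∀ s, f s ≤ C := by
  refine ⟨∑ s, |f s|, Finset.sum_nonneg fun _ _ => abs_nonneg _, fun s => ?_⟩
  exact (le_abs_self _).trans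
    (Finset.single_le_sum (f := fun s => |f s|) (fun _ _ => abs_nonneg _) (Finset.mem_univ s))

theorem stmt_9
    {S A : Type*} [Fintype S] [Nonempty S] [Fintype A] [Nonempty A]
    (P : S → A → S → ℝ) (hP0 : ∀ s a s', 0 ≤ P s a s')
    (hP1 : ∀ s a, ∑ s', P s a s' = 1)
    (r : S → A → ℝ) (γ : ℝ) (hγ0 : 0 ≤ γ) (hγ1 : γ < 1)
    (Qstar : S → A → ℝ) (hQstar : bellmanOp P r γ Qstar = Qstar)
    (α : ℝ) (hα0 : 0 ≤ α) (hα1 : α < 1)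
    (c : ℝ) (hc0 : 0 < c) (hc1 : c < 1) (Ql : ℝ)
    (Qseq : ℕ → S → A → ℝ)
    (hQseq : ∀ k, Qseq (k + 1) = clipOp P r γ α c Ql (Qseq k))
 :
    ∀ (s : S) (a : A),
      Vof Qstar s - Qstar s a ≤
        Filter.liminf (fun k => Vof (Qseq k) s - Qseq k s a) atTop := by
  classical
  obtain ⟨V, hV⟩ : ∃ V : ℕ → S → ℝ, ∀ k, V k = Vof (Qseq k) := ⟨_, fun _ => rfl⟩
  obtain ⟨W, hW⟩ : ∃ W : S → ℝ, W = Vof Qstar := ⟨_, rfl⟩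
  have hQs : ∀ s a, Qstar s a = r s a + γ * ∑ s', P s a s' * W s' := by
    intro s a
    conv_lhs => rw [← hQstar]
    rw [hW]; rfl
  have hup : ∀ k s a, Qseq (k+1) s a ≤ r s a + γ * ∑ s', P s a s' * V k s' := by
    intro k s a
    have := mul_nonneg hα0 (sub_nonneg.2 (Vof_ge (Qseq k) s a))
    rw [hQseq, hV]
    simp only [clipOp, alOp, bellmanOp]
    split_ifs <;> linarith
  have hlo : ∀ k s a, r s a + γ * ∑ s', P s a s' * V k s' - α * (V k s - Qseq k s a)
      ≤ Qseq (k+1) s a := by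
    intro k s a
    have := mul_nonneg hα0 (sub_nonneg.2 (Vof_ge (Qseq k) s a))
    rw [hQseq, hV]
    simp only [clipOp, alOp, bellmanOp]
    split_ifs <;> linarith
  have hge : ∀ k s a, Qseq k s a ≤ V k s := fun k s a => by rw [hV]; exact Vof_ge _ _ _
  have hatt : ∀ k s, ∃ a, Qseq k s a = V k s := fun k s => by rw [hV]; exact Vof_att _ _
  have hgeW : ∀ s a, Qstar s a ≤ W s := fun s a => by rw [hW]; exact Vof_ge _ _ _
  have hattW : ∀ s, ∃ a, Qstar s a = W s := fun s => by rw [hW]; exact Vof_att _ _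
  have hav : ∀ s a (v w : S → ℝ) (d : ℝ), (∀ s, v s ≤ w s + d) →
      γ * ∑ s', P s a s' * v s' ≤ γ * ∑ s', P s a s' * w s' + γ * d := by
    intro s a v w d h
    rw [← mul_add]
    exact mul_le_mul_of_nonneg_left (avg_mono _ (hP0 s a) (hP1 s a) v w d h) hγ0
  have hpow : Tendsto (fun k : ℕ => γ ^ k) atTop (𝓝 0) :=
    tendsto_pow_atTop_nhds_zero_of_lt_one hγ0 hγ1
  -- upper bound
  obtain ⟨C, hC0, hC⟩ := exists_ub (fun s => V 0 s - W s)
  have hVW : ∀ k s, V k s ≤ W s + γ ^ k * C := by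
    intro k
    induction k with
    | zero => intro s; have := hC s; simp only [pow_zero]; linarith
    | succ k ih =>
      intro s
      obtain ⟨a, ha⟩ := hatt (k+1) s
      have h1 := hup k s a
      have h2 := hav s a _ _ _ ih
      have h3 := hgeW s a
      rw [hQs] at h3
      rw [pow_succ]
      linarith
  -- almost monotone
  obtain ⟨D, hD0, hD⟩ := exists_ub (fun s => V 0 s - V 1 s)
  have hmon : ∀ k s, V k s ≤ V (k+1) s + γ ^ k * D := by
    intro k
    induction k with
    | zero => intro s; have := hD s; simp only [pow_zero, zero_add]; linarith
    | succ k ih =>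
      intro s
      obtain ⟨a, ha⟩ := hatt (k+1) s
      have h1 := hup k s a
      have h2 := hav s a _ _ _ ih
      have h3 := hlo (k+1) s a
      have h4 := hge (k+1+1) s a
      rw [ha, sub_self, mul_zero] at h3
      rw [pow_succ]
      linarith
  have hconv : ∀ s, ∃ l, Tendsto (fun k => V k s) atTop (𝓝 l) := by
    intro s
    have hm : Monotone (fun k => V k s - γ ^ k * (D / (1-γ))) := by
      apply monotone_nat_of_le_succ
      intro k
      have h1 := hmon k s
      have h2 : D / (1-γ) * (1-γ) = D := div_mul_cancel₀ _ (by linarith)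
      have h3 : γ ^ k * D = γ^k * (D/(1-γ)) - γ^(k+1) * (D/(1-γ)) := by
        conv_lhs => rw [← h2]
        ring
      linarith
    have hb : BddAbove (Set.range (fun k => V k s - γ ^ k * (D / (1-γ)))) := by
      refine ⟨W s + C, ?_⟩
      rintro _ ⟨k, rfl⟩
      have h1 := hVW k s
      have h2 : γ ^ k * C ≤ 1 * C :=
        mul_le_mul_of_nonneg_right (pow_le_one₀ hγ0 hγ1.le) hC0
      have h3 : 0 ≤ γ ^ k * (D / (1-γ)) :=
        mul_nonneg (pow_nonneg hγ0 _) (div_nonneg hD0 (by linarith))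
      simp only
      linarith
    have h := (tendsto_atTop_ciSup hm hb).add (hpow.mul_const (D / (1-γ)))
    refine ⟨_, h.congr fun k => ?_⟩
    ring
  choose U hU using hconv
  have hUW : ∀ s, U s ≤ W s := by
    intro s
    have h := (hpow.mul_const C).const_add (W s)
    rw [zero_mul, add_zero] at h
    exact le_of_tendsto_of_tendsto' (hU s) h (fun k => hVW k s)
  have hT : ∀ s a, Tendsto (fun k => r s a + γ * ∑ s', P s a s' * V k s') atTop
      (𝓝 (r s a + γ * ∑ s', P s a s' * U s')) := by
    intro s a
    exact ((tendsto_finsetSum _ fun s' _ => (hU s').const_mul (P s a s')).const_mul γ).const_add _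
  have hd : ∀ s a, Tendsto (fun k => r s a + γ * ∑ s', P s a s' * V k s' - α * V k s) atTop
      (𝓝 (r s a + γ * ∑ s', P s a s' * U s' - α * U s)) := fun s a =>
    (hT s a).sub ((hU s).const_mul α)
  have hsup : ∀ s a, r s a + γ * ∑ s', P s a s' * U s' ≤ U s := by
    intro s a
    by_contra hlt
    push Not at hlt
    obtain ⟨L, hL⟩ : ∃ L, (1-α) * (L - U s) * 2 = r s a + γ * ∑ s', P s a s' * U s' - U s :=
      ⟨U s + (r s a + γ * ∑ s', P s a s' * U s' - U s) / (2 * (1-α)), by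
        have : (1 - α) ≠ 0 := by linarith
        field_simp
        ring⟩
    have hLU : 0 < L - U s := by
      by_contra hn
      have := mul_nonneg (show 0 ≤ 1 - α by linarith) (show 0 ≤ -(L - U s) by linarith)
      linarith
    have hpos := mul_pos (show 0 < 1 - α by linarith) hLU
    have hev := (hd s a).eventually_const_le
      (show (1-α) * L < r s a + γ * ∑ s', P s a s' * U s' - α * U s by linarith)
    obtain ⟨K, hK⟩ := eventually_atTop.1 hev
    have hx : ∀ n, L + α ^ n * (Qseq K s a - L) ≤ Qseq (K + n) s a := by
      intro n
      induction n with
      | zero => simp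
      | succ n ih =>
        have h1 := hlo (K+n) s a
        have h2 := hK (K+n) (by omega)
        have h3 := mul_le_mul_of_nonneg_left ih hα0
        rw [← add_assoc, pow_succ]
        linarith
    have hl := ((tendsto_pow_atTop_nhds_zero_of_lt_one hα0 hα1).mul_const
      (Qseq K s a - L)).const_add L
    rw [zero_mul, add_zero] at hl
    have hu : Tendsto (fun n => V (K + n) s) atTop (𝓝 (U s)) :=
      (hU s).comp (tendsto_atTop_mono (fun n => Nat.le_add_left n K) tendsto_id)
    have := le_of_tendsto_of_tendsto' hl hu (fun n => (hx n).trans (hge _ _ _))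
    linarith
  have hWU : ∀ s, W s ≤ U s := by
    obtain ⟨m, hm⟩ := Finite.exists_max (fun s => W s - U s)
    obtain ⟨a, ha⟩ := hattW m
    have h1 := hav m a W U (W m - U m) (fun s => by have := hm s; linarith)
    have h2 := hsup m a
    rw [hQs] at ha
    have h3 : W m - U m ≤ 0 := by
      by_contra hn
      have := mul_pos (show 0 < 1 - γ by linarith) (not_le.1 hn)
      linarith
    intro s
    have := hm s
    linarith
  have hUeq : U = W := funext fun s => le_antisymm (hUW s) (hWU s)
  subst hUeq
  intro s a
  rw [← hW]
  simp only [← hV]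
  have hlim : Tendsto (fun k => V (k+1) s - (r s a + γ * ∑ s', P s a s' * V k s')) atTop
      (𝓝 (U s - Qstar s a)) := by
    rw [hQs]
    exact ((hU s).comp (tendsto_add_atTop_nat 1)).sub (hT s a)
  -- boundedness
  obtain ⟨B, hB⟩ := (hd s a).bddBelow_range
  obtain ⟨B', hB'⟩ := (hU s).bddAbove_range
  have hlow : ∀ k, min (B / (1-α)) (Qseq 0 s a) ≤ Qseq k s a := by
    intro k
    induction k with
    | zero => exact min_le_right _ _
    | succ k ih =>
      have h1 := hlo k s a
      have h2 := hB ⟨k, rfl⟩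
      have h3 := mul_le_mul_of_nonneg_left ih hα0
      have h4 := mul_le_mul_of_nonneg_left (min_le_left (B / (1-α)) (Qseq 0 s a))
        (show 0 ≤ 1 - α by linarith)
      rw [mul_div_cancel₀ _ (show 1 - α ≠ 0 by linarith)] at h4
      simp only at h2
      linarith
  have hcob : IsCoboundedUnder (· ≥ ·) atTop (fun k => V k s - Qseq k s a) := by
    apply IsBoundedUnder.isCoboundedUnder_ge
    refine ⟨B' - min (B / (1-α)) (Qseq 0 s a), ?_⟩
    rw [eventually_map]
    refine Eventually.of_forall fun k => ?_
    have h1 := hlow k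
    have h2 := hB' ⟨k, rfl⟩
    simp only at h2 ⊢
    linarith
  apply le_of_forall_lt
  intro b hb
  obtain ⟨b', hb1, hb2⟩ := exists_between hb
  refine hb1.trans_le (le_liminf_of_le hcob ?_)
  obtain ⟨K, hK⟩ := eventually_atTop.1 (hlim.eventually_const_le hb2)
  refine eventually_atTop.2 ⟨K+1, fun k hk => ?_⟩
  obtain ⟨j, rfl⟩ : ∃ j, k = j + 1 := ⟨k - 1, by omega⟩
  have h1 := hK j (by omega)
  have h2 := hup j s a
  linarith
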